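/- Let φ ∈ C_c(ℝ) and let λ ∈ ℂ be such that e^λ belongs to the spectrum of S = S_1. Then for every a ∈ ℝ one has |∫_ℝ φ(t) e^{λt} e^{iat} dt| ≤ ‖M_φ‖, where ‖M_φ‖ is the operator norm of the convolution operator M_φ on H. -/

import Mathlib

open MeasureTheory Complex Real Filter Topology

noncomputable section

/-- A Hilbert space `H` of (locally integrable) functions on `ℝ` satisfying the
hypotheses (H1)-(H4) of the paper. -/
structure MultiplierSetup (H : Type) [NormedAddCommGroup H]
    [InnerProductSpace ℂ H] [CompleteSpace H] where
  /-- the inclusion of `H` into (a.e. classes of) functions on `ℝ` -/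
  ι : H →ₗ[ℂ] (ℝ →ₘ[volume] ℂ)
  ι_inj : Function.Injective ι
  /-- `H ⊆ L¹_loc(ℝ)` -/
  locInt : ∀ f : H, LocallyIntegrable (ι f) volume
  /-- `C_c(ℝ) ⊆ H` -/
  ofCc : CompactlySupportedContinuousMap ℝ ℂ → H
  ofCc_spec : ∀ φ : CompactlySupportedContinuousMap ℝ ℂ,
    (ι (ofCc φ) : ℝ → ℂ) =ᵐ[volume] φ
  /-- `C_c(ℝ)` is dense in `H` -/
  ofCc_dense : DenseRange ofCc
  /-- (H1): both inclusions are continuous -/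
  incl_cont : ∀ K : Set ℝ, IsCompact K → ∃ c > 0,
    (∀ φ : CompactlySupportedContinuousMap ℝ ℂ, tsupport (φ : ℝ → ℂ) ⊆ K →
      ‖ofCc φ‖ ≤ c * ⨆ x, ‖φ x‖) ∧
    (∀ f : H, (∫ x in K, ‖(ι f : ℝ → ℂ) x‖) ≤ c * ‖f‖)
  /-- (H2): the translation group acting boundedly on `H` -/
  S : ℝ → H →L[ℂ] H
  S_spec : ∀ (x : ℝ) (f : H), ((ι (S x f)) : ℝ → ℂ) =ᵐ[volume]
    fun y => (ι f : ℝ → ℂ) (y - x)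
  S_add : ∀ x y : ℝ, (S x).comp (S y) = S (x + y)
  S_zero : S 0 = 1
  S_loc_bdd : ∀ K : Set ℝ, IsCompact K → ∃ C : ℝ, ∀ x ∈ K, ‖S x‖ ≤ C
  /-- (H3): the modulations act on `H`, uniformly boundedly -/
  T : ℝ → H →L[ℂ] H
  T_spec : ∀ (α : ℝ) (f : H), ((ι (T α f)) : ℝ → ℂ) =ᵐ[volume]
    fun x => Complex.exp (Complex.I * α * x) * (ι f : ℝ → ℂ) x
  T_bdd : ∃ C : ℝ, ∀ α : ℝ, ‖T α‖ ≤ C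
  /-- (H4): exponential bound on the norms of the translations -/
  S_exp : ∃ C > 0, ∃ a ≥ 0, ∀ x : ℝ, ‖S x‖ ≤ C * Real.exp (a * |x|)

/-- The character `t ↦ e^{ibt}` of the real line. -/
def realChar (b t : ℝ) : ℂ := Complex.exp (Complex.I * b * t)

/-- The frequency of the `k`-th `L`-periodic character. -/
def periodicFreq (L : ℝ) (k : ℤ) : ℝ := 2 * π * k / L

theorem realChar_add_left (b c t : ℝ) : realChar (b + c) t = realChar b t * realChar c t := by
  simp only [realChar, ← Complex.exp_add]
  push_cast
  ring_nf

theorem realChar_add_right (b s t : ℝ) : realChar b (s + t) = realChar b s * realChar b t := by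
  simp only [realChar, ← Complex.exp_add]
  push_cast
  ring_nf

@[simp]
theorem realChar_zero_left (t : ℝ) : realChar 0 t = 1 := by simp [realChar]

@[simp]
theorem realChar_zero_right (b : ℝ) : realChar b 0 = 1 := by simp [realChar]

@[simp]
theorem norm_realChar (b t : ℝ) : ‖realChar b t‖ = 1 := by
  have h : Complex.I * b * t = ((b * t : ℝ) : ℂ) * Complex.I := by push_cast; ring
  rw [realChar, h, Complex.norm_exp_ofReal_mul_I]

@[fun_prop]
theorem continuous_realChar (b : ℝ) : Continuous (realChar b) := by
  unfold realChar
  fun_prop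

theorem realChar_neg_periodicFreq_period {L : ℝ} (hL : L ≠ 0) (k : ℤ) :
    realChar (-periodicFreq L k) L = 1 := by
  rw [realChar, Complex.exp_eq_one_iff]
  refine ⟨-k, ?_⟩
  have : (L : ℂ) ≠ 0 := by exact_mod_cast hL
  simp only [periodicFreq]
  push_cast
  field_simp

theorem hasSum_sq_norm_integral_realChar {L a : ℝ} (hL : 0 < L) {f : ℝ → ℂ}
    (hf : MemLp f 2 (volume.restrict (Set.Ioc a (a + L)))) :
    HasSum (fun k : ℤ => ‖∫ t in a..(a + L), realChar (-periodicFreq L k) t • f t‖ ^ 2)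
      (L * ∫ t in a..(a + L), ‖f t‖ ^ 2) := by
  have hab : a < a + L := by linarith
  have h := (hasSum_sq_fourierCoeffOn hab hf).mul_left (L ^ 2)
  have hLL : a + L - a = L := by ring
  have e : ∀ (u v : ℤ → ℝ) (x y : ℝ), u = v → x = y → HasSum v y → HasSum u x := by
    rintro u _ x _ rfl rfl h
    exact h
  refine e _ _ _ _ ?_ ?_ h
  · funext k
    rw [fourierCoeffOn_eq_integral, norm_smul, mul_pow]
    have h2 : ∀ x : ℝ, (fourier (-k) (x : AddCircle (a + L - a)) : ℂ)
        = realChar (-periodicFreq L k) x := by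
      intro x
      rw [fourier_coe_apply, hLL, realChar, periodicFreq]
      congr 1
      push_cast
      ring
    simp_rw [h2, hLL]
    rw [Real.norm_of_nonneg (by positivity)]
    field_simp
  · rw [hLL, smul_eq_mul]
    field_simp

theorem sum_sq_norm_integral_realChar_le {L c d : ℝ} (hL : 0 < L) (hcd : c ≤ d) (hdL : d ≤ c + L)
    {f : ℝ → ℂ} (hf : Continuous f) (A : Finset ℤ) :
    ∑ k ∈ A, ‖∫ t in c..d, realChar (-periodicFreq L k) t • f t‖ ^ 2
      ≤ L * ∫ t in c..d, ‖f t‖ ^ 2 := by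
  have hsub : Set.Ioc c d ⊆ Set.Ioc c (c + L) := Set.Ioc_subset_Ioc_right hdL
  have hmem : MemLp ((Set.Ioc c d).indicator f) 2 (volume.restrict (Set.Ioc c (c + L))) := by
    refine MemLp.indicator measurableSet_Ioc ?_
    obtain ⟨C, hC⟩ := (isCompact_Icc (a := c) (b := c + L)).exists_bound_of_continuousOn
      hf.continuousOn
    refine MemLp.of_bound hf.aestronglyMeasurable C ?_
    filter_upwards [ae_restrict_mem measurableSet_Ioc] with x hx
    exact hC x ⟨hx.1.le, hx.2⟩
  have key : ∀ (E : Type) [NormedAddCommGroup E] [NormedSpace ℝ E] (g : ℝ → E),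
      ∫ t in c..(c + L), (Set.Ioc c d).indicator g t = ∫ t in c..d, g t := by
    intro E _ _ g
    rw [intervalIntegral.integral_of_le (by linarith), intervalIntegral.integral_of_le hcd,
      setIntegral_indicator measurableSet_Ioc, Set.inter_eq_self_of_subset_right hsub]
  have h := hasSum_sq_norm_integral_realChar hL hmem
  have h1 : ∀ k : ℤ, (fun t => realChar (-periodicFreq L k) t • (Set.Ioc c d).indicator f t)
      = (Set.Ioc c d).indicator fun t => realChar (-periodicFreq L k) t • f t := by
    intro k
    funext t
    by_cases ht : t ∈ Set.Ioc c d <;> simp [ht]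
  have h2 : (fun t => ‖(Set.Ioc c d).indicator f t‖ ^ 2)
      = (Set.Ioc c d).indicator fun t => ‖f t‖ ^ 2 := by
    funext t
    by_cases ht : t ∈ Set.Ioc c d <;> simp [ht]
  simp_rw [h1, h2, key] at h
  exact sum_le_hasSum A (fun _ _ => by positivity) h

section HilbertValued

variable {H : Type*} [NormedAddCommGroup H] [InnerProductSpace ℂ H] [CompleteSpace H]

theorem inner_integral_realChar_smul {F : ℝ → H} (hF : Continuous F) (v : H) (b c d : ℝ) :
    inner ℂ v (∫ t in c..d, realChar b t • F t)
      = ∫ t in c..d, realChar b t • inner ℂ v (F t) := by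
  have h := (innerSL ℂ v).intervalIntegral_comp_comm (a := c) (b := d) (μ := volume)
    (f := fun t => realChar b t • F t)
    (Continuous.intervalIntegrable (by fun_prop) _ _)
  simpa [inner_smul_right] using h.symm

theorem sum_sq_norm_integral_realChar_smul_le {L c d : ℝ} (hL : 0 < L) (hcd : c ≤ d)
    (hdL : d ≤ c + L) {F : ℝ → H} (hF : Continuous F) (A : Finset ℤ) :
    ∑ k ∈ A, ‖∫ t in c..d, realChar (-periodicFreq L k) t • F t‖ ^ 2
      ≤ L * ∫ t in c..d, ‖F t‖ ^ 2 := by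
  set W : ℤ → H := fun k => ∫ t in c..d, realChar (-periodicFreq L k) t • F t with hW
  let V : Submodule ℂ H := Submodule.span ℂ (W '' (A : Set ℤ))
  have : FiniteDimensional ℂ V := FiniteDimensional.span_of_finite ℂ (A.finite_toSet.image W)
  let b := stdOrthonormalBasis ℂ V
  have hb : Orthonormal ℂ (fun i => (b i : H)) := b.orthonormal.comp_linearIsometry V.subtypeₗᵢ
  have h1 : ∀ k ∈ A, ‖W k‖ ^ 2 = ∑ i, ‖inner ℂ (b i : H) (W k)‖ ^ 2 := by
    intro k hk
    have hmem : W k ∈ V := Submodule.subset_span ⟨k, hk, rfl⟩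
    have := b.sum_sq_norm_inner_right ⟨W k, hmem⟩
    simpa using this.symm
  have hint : ∀ i, IntervalIntegrable (fun t => ‖inner ℂ (b i : H) (F t)‖ ^ 2) volume c d :=
    fun i => Continuous.intervalIntegrable (by fun_prop) _ _
  calc ∑ k ∈ A, ‖W k‖ ^ 2 = ∑ i, ∑ k ∈ A, ‖inner ℂ (b i : H) (W k)‖ ^ 2 := by
        rw [Finset.sum_congr rfl h1, Finset.sum_comm]
    _ ≤ ∑ i, L * ∫ t in c..d, ‖inner ℂ (b i : H) (F t)‖ ^ 2 := by
        refine Finset.sum_le_sum fun i _ => ?_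
        simp_rw [hW, inner_integral_realChar_smul hF]
        exact sum_sq_norm_integral_realChar_le hL hcd hdL (by fun_prop) A
    _ = L * ∫ t in c..d, ∑ i, ‖inner ℂ (b i : H) (F t)‖ ^ 2 := by
        rw [intervalIntegral.integral_finsetSum fun i _ => hint i, Finset.mul_sum]
    _ ≤ L * ∫ t in c..d, ‖F t‖ ^ 2 := by
        refine mul_le_mul_of_nonneg_left ?_ hL.le
        refine intervalIntegral.integral_mono_on hcd
          (Continuous.intervalIntegrable (by fun_prop) _ _)
          (Continuous.intervalIntegrable (by fun_prop) _ _) fun t _ => ?_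
        exact hb.sum_inner_products_le _

theorem integral_sq_norm_le_of_forall_sum_le {L Q : ℝ} (hL : 0 < L) {F : ℝ → H}
    (hF : Continuous F)
    (hQ : ∀ A : Finset ℤ,
      ∑ k ∈ A, ‖∫ t in (0 : ℝ)..L, realChar (-periodicFreq L k) t • F t‖ ^ 2 ≤ Q) :
    L * ∫ t in (0 : ℝ)..L, ‖F t‖ ^ 2 ≤ Q := by
  refine le_of_forall_pos_le_add fun ε hε => ?_
  set η : ℝ := √ε / L with hη
  have hηpos : 0 < η := by positivity
  have hηε : L * (L * η ^ 2) = ε := by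
    rw [hη, div_pow, Real.sq_sqrt hε.le]
    field_simp
  obtain ⟨y, -, hyf, hy⟩ := ((isCompact_Icc (a := 0) (b := L)).image hF).finite_cover_balls hηpos
  let V : Submodule ℂ H := Submodule.span ℂ y
  have : FiniteDimensional ℂ V := FiniteDimensional.span_of_finite ℂ hyf
  let b := stdOrthonormalBasis ℂ V
  have hb : Orthonormal ℂ (fun i => (b i : H)) := b.orthonormal.comp_linearIsometry V.subtypeₗᵢ
  have hint : ∀ i, IntervalIntegrable (fun t => ‖inner ℂ (b i : H) (F t)‖ ^ 2) volume 0 L :=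
    fun i => Continuous.intervalIntegrable (by fun_prop) _ _
  have hpt : ∀ t ∈ Set.Icc 0 L, ‖F t‖ ^ 2 ≤ ∑ i, ‖inner ℂ (b i : H) (F t)‖ ^ 2 + η ^ 2 := by
    intro t ht
    have h1 := hy ⟨t, ht, rfl⟩
    simp only [Set.mem_iUnion, Metric.mem_ball, dist_eq_norm, exists_prop] at h1
    obtain ⟨z, hz, hzt⟩ := h1
    have hzV : z ∈ V := Submodule.subset_span hz
    have h2 : ‖F t - V.starProjection (F t)‖ ≤ ‖F t - z‖ := by
      rw [V.starProjection_minimal]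
      exact ciInf_le ⟨0, by rintro _ ⟨w, rfl⟩; positivity⟩ (⟨z, hzV⟩ : V)
    have h3 := b.sum_sq_norm_inner_right (V.orthogonalProjectionOnto (F t))
    have h4 : ∀ i, inner ℂ (b i) (V.orthogonalProjectionOnto (F t)) = inner ℂ (b i : H) (F t) :=
      fun i => by simp
    simp_rw [h4] at h3
    have h5 := V.norm_sq_eq_add_norm_sq_starProjection (F t)
    have h6 : ‖Vᗮ.starProjection (F t)‖ ≤ η := by
      rw [Submodule.starProjection_orthogonal_val]
      exact h2.trans hzt.le
    rw [h5, h3, Submodule.starProjection_apply, Submodule.coe_norm]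
    gcongr
  have hsum : HasSum (fun k : ℤ => ∑ i, ‖inner ℂ (b i : H)
      (∫ t in (0 : ℝ)..L, realChar (-periodicFreq L k) t • F t)‖ ^ 2)
      (∑ i, L * ∫ t in (0 : ℝ)..L, ‖inner ℂ (b i : H) (F t)‖ ^ 2) := by
    refine hasSum_sum fun i _ => ?_
    simp_rw [inner_integral_realChar_smul hF]
    have h := hasSum_sq_norm_integral_realChar (a := 0) (f := fun t => inner ℂ (b i : H) (F t)) hL
    rw [zero_add] at h
    refine h ?_
    have hc : Continuous fun t => inner ℂ (b i : H) (F t) := by fun_prop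
    obtain ⟨C, hC⟩ := (isCompact_Icc (a := 0) (b := L)).exists_bound_of_continuousOn
      hc.continuousOn
    refine MemLp.of_bound hc.aestronglyMeasurable C ?_
    filter_upwards [ae_restrict_mem measurableSet_Ioc] with x hx
    exact hC x ⟨hx.1.le, hx.2⟩
  have hle : ∑ i, L * ∫ t in (0 : ℝ)..L, ‖inner ℂ (b i : H) (F t)‖ ^ 2 ≤ Q := by
    refine hasSum_le_of_sum_le hsum fun A => le_trans (Finset.sum_le_sum fun k _ => ?_) (hQ A)
    exact hb.sum_inner_products_le _
  calc L * ∫ t in (0 : ℝ)..L, ‖F t‖ ^ 2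
      ≤ L * ∫ t in (0 : ℝ)..L, (∑ i, ‖inner ℂ (b i : H) (F t)‖ ^ 2 + η ^ 2) := by
        refine mul_le_mul_of_nonneg_left ?_ hL.le
        exact intervalIntegral.integral_mono_on hL.le
          (Continuous.intervalIntegrable (by fun_prop) _ _)
          (Continuous.intervalIntegrable (by fun_prop) _ _) hpt
    _ = ∑ i, L * (∫ t in (0 : ℝ)..L, ‖inner ℂ (b i : H) (F t)‖ ^ 2) + ε := by
        rw [intervalIntegral.integral_add (Continuous.intervalIntegrable (by fun_prop) _ _)
          (Continuous.intervalIntegrable (by fun_prop) _ _),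
          intervalIntegral.integral_finsetSum fun i _ => hint i, mul_add, Finset.mul_sum]
        simp [hηε]
    _ ≤ Q + ε := by gcongr

end HilbertValued

theorem sq_integral_mul_le {w g : ℝ → ℝ} (hw : 0 ≤ w) (h0 : Integrable w)
    (h1 : Integrable fun s => w s * g s) (h2 : Integrable fun s => w s * g s ^ 2) :
    (∫ s, w s * g s) ^ 2 ≤ (∫ s, w s) * ∫ s, w s * g s ^ 2 := by
  have h : ∀ c : ℝ, 0 ≤ (∫ s, w s) * (c * c) + (-(2 * ∫ s, w s * g s)) * c
      + ∫ s, w s * g s ^ 2 := by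
    intro c
    have hpos : 0 ≤ ∫ s, w s * (c - g s) ^ 2 :=
      integral_nonneg fun s => mul_nonneg (hw s) (sq_nonneg _)
    have heq : ∫ s, w s * (c - g s) ^ 2
        = ∫ s, (c * c * w s - 2 * c * (w s * g s) + w s * g s ^ 2) := by
      congr 1
      funext s
      ring
    have h01 : Integrable fun s => c * c * w s - 2 * c * (w s * g s) :=
      (h0.const_mul _).sub (h1.const_mul _)
    rw [heq, integral_add h01 h2, integral_sub (h0.const_mul _) (h1.const_mul _),
      integral_const_mul, integral_const_mul] at hpos
    linarith
  have := discrim_le_zero h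
  rw [discrim] at this
  linarith

section OperatorGroup

variable {H : Type*} [NormedAddCommGroup H] [InnerProductSpace ℂ H]

/-- A locally bounded, strongly continuous one-parameter group of operators, together with a
uniformly bounded family of modulations intertwining it with its unimodular multiples. -/
structure IsModulatedGroup (U T : ℝ → H →L[ℂ] H) : Prop where
  zero : U 0 = 1
  add : ∀ s t x, U (s + t) x = U s (U t x)
  cont : ∀ x, Continuous fun t => U t x
  bdd : ∀ R : ℝ, ∃ M > 0, ∀ t : ℝ, |t| ≤ R → ‖U t‖ ≤ M
  mod_bdd : ∃ C > 0, ∀ α : ℝ, ‖T α‖ ≤ C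
  mod_inv : ∀ α x, T α (T (-α) x) = x
  mod_comm : ∀ α s x, T α (U s x) = realChar α s • U s (T α x)

namespace IsModulatedGroup

variable {U T : ℝ → H →L[ℂ] H}

theorem apply_comm (h : IsModulatedGroup U T) (s t : ℝ) (x : H) : U s (U t x) = U t (U s x) := by
  rw [← h.add, ← h.add, add_comm]

/-- The `k`-th Fourier coefficient over `[0, L]` of the orbit of a vector. -/
def orbitCoeff (h : IsModulatedGroup U T) (L : ℝ) (k : ℤ) : H →L[ℂ] H :=
  LinearMap.mkContinuousOfExistsBound
    { toFun := fun x => ∫ t in (0 : ℝ)..L, realChar (-periodicFreq L k) t • U t x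
      map_add' := fun x y => by
        have := h.cont
        simp only [map_add, smul_add]
        exact intervalIntegral.integral_add (Continuous.intervalIntegrable (by fun_prop) _ _)
          (Continuous.intervalIntegrable (by fun_prop) _ _)
      map_smul' := fun c x => by
        simp only [map_smul, RingHom.id_apply]
        rw [← intervalIntegral.integral_smul]
        simp only [smul_comm c] }
    (by
      obtain ⟨M, -, hM⟩ := h.bdd |L|
      refine ⟨M * |L|, fun x => ?_⟩
      have hb : ∀ t ∈ Set.uIoc 0 L, ‖realChar (-periodicFreq L k) t • U t x‖ ≤ M * ‖x‖ := by
        intro t ht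
        rw [norm_smul, norm_realChar, one_mul]
        refine (U t).le_of_opNorm_le (hM t ?_) x
        rcases le_total 0 L with hL | hL
        · rw [Set.uIoc_of_le hL] at ht
          rw [abs_of_pos ht.1, abs_of_nonneg hL]
          exact ht.2
        · rw [Set.uIoc_of_ge hL] at ht
          rw [abs_of_nonpos ht.2, abs_of_nonpos hL]
          linarith [ht.1]
      have h1 := intervalIntegral.norm_integral_le_of_norm_le_const hb
      rw [sub_zero] at h1
      exact h1.trans_eq (by ring))

theorem orbitCoeff_apply (h : IsModulatedGroup U T) (L : ℝ) (k : ℤ) (x : H) :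
    h.orbitCoeff L k x = ∫ t in (0 : ℝ)..L, realChar (-periodicFreq L k) t • U t x := rfl

variable [CompleteSpace H]

theorem apply_integral (h : IsModulatedGroup U T) (A : H →L[ℂ] H) (b c d : ℝ) (x : H) :
    A (∫ t in c..d, realChar b t • U t x) = ∫ t in c..d, realChar b t • A (U t x) := by
  have := h.cont
  rw [← A.intervalIntegral_comp_comm (Continuous.intervalIntegrable (by fun_prop) _ _)]
  simp only [map_smul]

theorem orbitCoeff_apply_apply (h : IsModulatedGroup U T) (L : ℝ) (k : ℤ) (s : ℝ) (x : H) :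
    h.orbitCoeff L k (U s x) = U s (h.orbitCoeff L k x) := by
  rw [orbitCoeff_apply, orbitCoeff_apply, h.apply_integral]
  simp only [h.apply_comm s]

theorem apply_orbitCoeff_sub (h : IsModulatedGroup U T) {L : ℝ} (hL : L ≠ 0) (k : ℤ) (s : ℝ)
    (x : H) :
    U s (h.orbitCoeff L k x) - realChar (periodicFreq L k) s • h.orbitCoeff L k x
      = realChar (periodicFreq L k) s •
        ∫ t in (0 : ℝ)..s, realChar (-periodicFreq L k) t • U t (U L x - x) := by
  set Φ : ℝ → H := fun t => realChar (-periodicFreq L k) t • U t x with hΦ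
  have hc := h.cont
  have hΦc : Continuous Φ := by fun_prop
  have hi : ∀ a b : ℝ, IntervalIntegrable Φ volume a b := fun a b => hΦc.intervalIntegrable _ _
  have hch : realChar (periodicFreq L k) s * realChar (-periodicFreq L k) s = 1 := by
    rw [← realChar_add_left]
    simp
  have h1 : U s (h.orbitCoeff L k x)
      = realChar (periodicFreq L k) s • ∫ t in s..(L + s), Φ t := by
    have hshift := intervalIntegral.integral_comp_add_right (a := 0) (b := L) Φ s
    rw [zero_add] at hshift
    rw [orbitCoeff_apply, h.apply_integral, ← hshift, ← intervalIntegral.integral_smul]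
    refine intervalIntegral.integral_congr fun t _ => ?_
    simp only [hΦ]
    rw [smul_smul, realChar_add_right, add_comm t s, h.add,
      show realChar (periodicFreq L k) s
        * (realChar (-periodicFreq L k) t * realChar (-periodicFreq L k) s)
        = realChar (periodicFreq L k) s * realChar (-periodicFreq L k) s
          * realChar (-periodicFreq L k) t by ring, hch, one_mul]
  have h2 : ∫ t in (0 : ℝ)..s, realChar (-periodicFreq L k) t • U t (U L x - x)
      = (∫ t in L..(L + s), Φ t) - ∫ t in (0 : ℝ)..s, Φ t := by
    have hshift := intervalIntegral.integral_comp_add_right (a := 0) (b := s) Φ L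
    rw [zero_add, add_comm s L] at hshift
    rw [← hshift, ← intervalIntegral.integral_sub
      (Continuous.intervalIntegrable (by fun_prop) _ _) (hi _ _)]
    refine intervalIntegral.integral_congr fun t _ => ?_
    simp only [hΦ]
    rw [realChar_add_right, realChar_neg_periodicFreq_period hL, mul_one, h.add, map_sub, smul_sub]
  have h3 : (∫ t in (0 : ℝ)..s, Φ t) + ∫ t in s..(L + s), Φ t
      = (∫ t in (0 : ℝ)..L, Φ t) + ∫ t in L..(L + s), Φ t := by
    rw [intervalIntegral.integral_add_adjacent_intervals (hi _ _) (hi _ _),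
      intervalIntegral.integral_add_adjacent_intervals (hi _ _) (hi _ _)]
  rw [h1, h2, orbitCoeff_apply, ← smul_sub]
  congr 1
  rw [sub_eq_sub_iff_add_eq_add, add_comm, h3, add_comm]

/-- If the multiplier `N = ∫ φ(s) U_s ds` minus its symbol at `b` is bounded below, then so is
`U_L - 1`. -/
theorem exists_norm_le_mul_norm_sub (h : IsModulatedGroup U T) {L : ℝ} (hL : 0 < L) {φ : ℝ → ℂ}
    (hφ : Continuous φ) (hφL : ∀ s, φ s ≠ 0 → |s| ≤ L) {N : H →L[ℂ] H}
    (hN : ∀ x, N x = ∫ s, φ s • U s x) {b B : ℝ} (hB : 0 ≤ B)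
    (hD : ∀ y, ‖y‖ ≤ B * ‖(∫ s, φ s * realChar b s) • y - N y‖) :
    ∃ K : ℝ, ∀ f, ‖f‖ ≤ K * ‖U L f - f‖ := by
  obtain ⟨M, hM0, hM⟩ := h.bdd L
  obtain ⟨C, hC0, hC⟩ := h.mod_bdd
  have hUc := h.cont
  have hφs : HasCompactSupport φ := by
    refine HasCompactSupport.intro (isCompact_Icc (a := -L) (b := L)) fun s hs => ?_
    by_contra hne
    exact hs (abs_le.mp (hφL s hne))
  set m : ℝ := ∫ s, ‖φ s‖ with hm
  have hm0 : 0 ≤ m := integral_nonneg fun _ => norm_nonneg _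
  have hinv : ∀ α x, T (-α) (T α x) = x := fun α x => by
    simpa using h.mod_inv (-α) x
  set G : H → ℤ → ℝ → H := fun f k s =>
    ∫ t in (0 : ℝ)..s, realChar (-periodicFreq L k) t • U t (U L f - f) with hG
  have hGc : ∀ f k, Continuous (G f k) := fun f k =>
    intervalIntegral.continuous_primitive
      (fun _ _ => Continuous.intervalIntegrable (by fun_prop) _ _) 0
  have hcs : ∀ g : ℝ → ℝ, HasCompactSupport fun s => ‖φ s‖ * g s := fun g => hφs.norm.mul_right
  have hcsmul : ∀ g : ℝ → H, HasCompactSupport fun s => φ s • g s := fun g => hφs.smul_right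
  have hcoeff : ∀ f k, ‖h.orbitCoeff L k f‖ ≤ C * B * C * ∫ s, ‖φ s‖ * ‖G f k s‖ := by
    intro f k
    set g := h.orbitCoeff L k f
    set α := periodicFreq L k - b with hα
    have h1 : ‖g‖ ≤ C * ‖T α g‖ := by
      conv_lhs => rw [← hinv α g]
      exact (T (-α)).le_of_opNorm_le (hC _) _
    have hpt : ∀ s, ‖realChar b s • T α g - U s (T α g)‖ ≤ C * ‖G f k s‖ := by
      intro s
      have hE := h.apply_orbitCoeff_sub hL.ne' k s f
      have h2 : U s (T α g) = realChar (-α) s • T α (U s g) := by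
        rw [h.mod_comm, smul_smul, ← realChar_add_left]
        simp
      have h3 : realChar b s • T α g
          = realChar (-α) s • T α (realChar (periodicFreq L k) s • g) := by
        rw [map_smul, smul_smul, ← realChar_add_left, hα]
        congr 2
        ring
      rw [h2, h3, ← smul_sub, ← map_sub, norm_smul, norm_realChar, one_mul]
      refine ((T α).le_of_opNorm_le (hC _) _).trans ?_
      rw [norm_sub_rev, hE, norm_smul, norm_realChar, one_mul]
    have h4 : (∫ s, φ s * realChar b s) • T α g - N (T α g)
        = ∫ s, φ s • (realChar b s • T α g - U s (T α g)) := by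
      rw [hN, ← integral_smul_const, ← integral_sub]
      · simp only [smul_sub, smul_smul]
      · simp only [mul_smul]
        exact Continuous.integrable_of_hasCompactSupport (by fun_prop) (hcsmul _)
      · exact Continuous.integrable_of_hasCompactSupport (by fun_prop) (hcsmul _)
    have h5 : ‖(∫ s, φ s * realChar b s) • T α g - N (T α g)‖ ≤ C * ∫ s, ‖φ s‖ * ‖G f k s‖ := by
      rw [h4, ← integral_const_mul]
      refine norm_integral_le_of_norm_le
        ((Continuous.integrable_of_hasCompactSupport (by fun_prop) (hcs _)).const_mul C)
        (Eventually.of_forall fun s => ?_)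
      rw [norm_smul, mul_left_comm]
      exact mul_le_mul_of_nonneg_left (hpt s) (norm_nonneg _)
    calc ‖g‖ ≤ C * (B * (C * ∫ s, ‖φ s‖ * ‖G f k s‖)) := by
          refine h1.trans ?_
          gcongr
          refine (hD _).trans ?_
          gcongr
      _ = _ := by ring
  have hGsum : ∀ f (A : Finset ℤ) s, |s| ≤ L →
      ∑ k ∈ A, ‖G f k s‖ ^ 2 ≤ L * (L * (M * ‖U L f - f‖) ^ 2) := by
    intro f A s hs
    have hF : Continuous fun t => U t (U L f - f) := hUc _
    have hint : ∀ c d : ℝ, c ≤ d → d ≤ c + L → (∀ t ∈ Set.Icc c d, |t| ≤ L) →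
        L * ∫ t in c..d, ‖U t (U L f - f)‖ ^ 2 ≤ L * (L * (M * ‖U L f - f‖) ^ 2) := by
      intro c d hcd hdL ht
      refine mul_le_mul_of_nonneg_left ?_ hL.le
      calc ∫ t in c..d, ‖U t (U L f - f)‖ ^ 2
          ≤ ∫ t in c..d, (M * ‖U L f - f‖) ^ 2 := by
            refine intervalIntegral.integral_mono_on hcd
              (Continuous.intervalIntegrable (by fun_prop) _ _)
              (Continuous.intervalIntegrable (by fun_prop) _ _) fun t htm => ?_
            gcongr
            exact (U t).le_of_opNorm_le (hM t (ht t htm)) _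
        _ = (d - c) * (M * ‖U L f - f‖) ^ 2 := by simp
        _ ≤ L * (M * ‖U L f - f‖) ^ 2 := by
            gcongr
            linarith
    obtain ⟨hs1, hs2⟩ := abs_le.mp hs
    rcases le_total 0 s with h0 | h0
    · exact (sum_sq_norm_integral_realChar_smul_le hL h0 (by linarith) hF A).trans
        (hint 0 s h0 (by linarith) fun t ht => abs_le.mpr ⟨by linarith [ht.1], by linarith [ht.2]⟩)
    · have hsym : ∀ k, ‖G f k s‖
          = ‖∫ t in s..0, realChar (-periodicFreq L k) t • U t (U L f - f)‖ := fun k => by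
        simp only [hG]
        rw [intervalIntegral.integral_symm, norm_neg]
      simp only [hsym]
      exact (sum_sq_norm_integral_realChar_smul_le hL h0 (by linarith) hF A).trans
        (hint s 0 h0 (by linarith) fun t ht => abs_le.mpr ⟨by linarith [ht.1], by linarith [ht.2]⟩)
  have hsum : ∀ f (A : Finset ℤ), ∑ k ∈ A, ‖h.orbitCoeff L k f‖ ^ 2
      ≤ (C * B * C * m * L * M * ‖U L f - f‖) ^ 2 := by
    intro f A
    have hint2 : ∀ k, Integrable fun s => ‖φ s‖ * ‖G f k s‖ ^ 2 := fun k =>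
      Continuous.integrable_of_hasCompactSupport (by fun_prop) (hcs _)
    have hφi : Integrable fun s => ‖φ s‖ :=
      Continuous.integrable_of_hasCompactSupport (by fun_prop) hφs.norm
    calc ∑ k ∈ A, ‖h.orbitCoeff L k f‖ ^ 2
        ≤ ∑ k ∈ A, (C * B * C) ^ 2 * (m * ∫ s, ‖φ s‖ * ‖G f k s‖ ^ 2) := by
          refine Finset.sum_le_sum fun k _ => ?_
          refine (pow_le_pow_left₀ (norm_nonneg _) (hcoeff f k) 2).trans ?_
          rw [mul_pow]
          gcongr
          exact sq_integral_mul_le (fun _ => norm_nonneg _) hφi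
            (Continuous.integrable_of_hasCompactSupport (by fun_prop) (hcs _)) (hint2 k)
      _ = (C * B * C) ^ 2 * (m * ∫ s, ‖φ s‖ * ∑ k ∈ A, ‖G f k s‖ ^ 2) := by
          rw [← Finset.mul_sum, ← Finset.mul_sum, ← integral_finsetSum _ fun k _ => hint2 k]
          simp only [Finset.mul_sum]
      _ ≤ (C * B * C) ^ 2 * (m * ∫ s, ‖φ s‖ * (L * (L * (M * ‖U L f - f‖) ^ 2))) := by
          refine mul_le_mul_of_nonneg_left (mul_le_mul_of_nonneg_left ?_ hm0) (sq_nonneg _)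
          refine integral_mono
            (Continuous.integrable_of_hasCompactSupport (by fun_prop) (hcs _))
            (hφi.mul_const _) fun s => ?_
          by_cases hs : φ s = 0
          · simp [hs]
          · exact mul_le_mul_of_nonneg_left (hGsum f A s (hφL s hs)) (norm_nonneg _)
      _ = (C * B * C * m * L * M * ‖U L f - f‖) ^ 2 := by
          rw [integral_mul_const]
          ring
  refine ⟨M * (C * B * C * m * M), fun f => ?_⟩
  have hpar := integral_sq_norm_le_of_forall_sum_le hL (hUc f) (hsum f)
  have hlow : ∀ t ∈ Set.Icc 0 L, ‖f‖ ^ 2 ≤ (M * ‖U t f‖) ^ 2 := by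
    intro t ht
    have hback : U (-t) (U t f) = f := by
      rw [← h.add, neg_add_cancel, h.zero]
      rfl
    refine pow_le_pow_left₀ (norm_nonneg _) ?_ 2
    conv_lhs => rw [← hback]
    refine (U (-t)).le_of_opNorm_le (hM _ ?_) _
    rw [abs_neg, abs_of_nonneg ht.1]
    exact ht.2
  have hlow2 : L * ‖f‖ ^ 2 ≤ M ^ 2 * ∫ t in (0 : ℝ)..L, ‖U t f‖ ^ 2 := by
    have hmono := intervalIntegral.integral_mono_on (μ := volume) hL.le
      (Continuous.intervalIntegrable (by fun_prop) _ _)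
      (Continuous.intervalIntegrable (by fun_prop) _ _) hlow
    simpa [mul_pow] using hmono
  have hfin : (L * ‖f‖) ^ 2 ≤ (L * (M * (C * B * C * m * M) * ‖U L f - f‖)) ^ 2 := by
    calc (L * ‖f‖) ^ 2 = L * (L * ‖f‖ ^ 2) := by ring
      _ ≤ L * (M ^ 2 * ∫ t in (0 : ℝ)..L, ‖U t f‖ ^ 2) := by gcongr
      _ = M ^ 2 * (L * ∫ t in (0 : ℝ)..L, ‖U t f‖ ^ 2) := by ring
      _ ≤ M ^ 2 * (C * B * C * m * L * M * ‖U L f - f‖) ^ 2 := by gcongr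
      _ = _ := by ring
  exact le_of_mul_le_mul_left (le_of_sq_le_sq hfin (by positivity)) hL

/-- If the multiplier `N = ∫ φ(s) U_s ds` minus its symbol at `b` is onto, then `U_L - 1` has
dense range. -/
theorem eq_zero_of_forall_inner_sub_eq_zero (h : IsModulatedGroup U T) {L : ℝ} (hL : 0 < L)
    {φ : ℝ → ℂ} (hφ : Continuous φ) (hφs : HasCompactSupport φ) {N : H →L[ℂ] H}
    (hN : ∀ x, N x = ∫ s, φ s • U s x) {b : ℝ}
    (hD : ∀ y, ∃ x, (∫ s, φ s * realChar b s) • x - N x = y) {v : H}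
    (hv : ∀ x, inner ℂ v (U L x - x) = 0) : v = 0 := by
  have hUc := h.cont
  have hinv : ∀ y, inner ℂ v (U L y) = inner ℂ v y := fun y => by
    rw [← sub_eq_zero, ← inner_sub_right, hv]
  have hcoeff : ∀ k y, inner ℂ v (h.orbitCoeff L k y) = 0 := by
    intro k y
    set α := b - periodicFreq L k with hα
    set ℓ : H →L[ℂ] ℂ := (innerSL ℂ v).comp ((h.orbitCoeff L k).comp (T α)) with hℓ
    have hℓU : ∀ s x, ℓ (U s x) = realChar b s * ℓ x := by
      intro s x
      have hE := congrArg (inner ℂ v) (h.apply_orbitCoeff_sub hL.ne' k s (T α x))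
      have hz : inner ℂ v (∫ t in (0 : ℝ)..s,
          realChar (-periodicFreq L k) t • U t (U L (T α x) - T α x)) = 0 := by
        rw [inner_integral_realChar_smul (hUc _)]
        simp [h.apply_comm _ L, hinv]
      rw [inner_smul_right, hz, mul_zero, inner_sub_right, sub_eq_zero, inner_smul_right] at hE
      have hb : realChar b s = realChar α s * realChar (periodicFreq L k) s := by
        rw [← realChar_add_left, hα, sub_add_cancel]
      simp only [hℓ, ContinuousLinearMap.comp_apply, innerSL_apply_apply]
      rw [h.mod_comm, map_smul, inner_smul_right, h.orbitCoeff_apply_apply, hE, hb, mul_assoc]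
    have hℓN : ∀ x, ℓ (N x) = (∫ s, φ s * realChar b s) * ℓ x := by
      intro x
      have hint : Integrable fun s => φ s • U s x :=
        Continuous.integrable_of_hasCompactSupport (by fun_prop) hφs.smul_right
      rw [hN, ← ℓ.integral_comp_comm hint, ← integral_mul_const]
      simp only [map_smul, hℓU, smul_eq_mul, mul_assoc]
    obtain ⟨x, hx⟩ := hD (T (-α) y)
    have h0 : ℓ (T (-α) y) = 0 := by
      rw [← hx, map_sub, map_smul, hℓN, smul_eq_mul, sub_self]
    simpa [hℓ, h.mod_inv] using h0
  have hcont : Continuous fun t => inner ℂ v (U t v) := by fun_prop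
  have hzero : L * ∫ t in (0 : ℝ)..L, ‖inner ℂ v (U t v)‖ ^ 2 ≤ 0 := by
    refine integral_sq_norm_le_of_forall_sum_le hL hcont fun A => ?_
    refine (Finset.sum_eq_zero fun k _ => ?_).le
    have := hcoeff k v
    rw [orbitCoeff_apply, inner_integral_realChar_smul (hUc v)] at this
    rw [this]
    simp
  by_contra hne
  have hpos : 0 < ∫ t in (0 : ℝ)..L, ‖inner ℂ v (U t v)‖ ^ 2 := by
    refine intervalIntegral.integral_pos hL (by fun_prop) (fun _ _ => by positivity)
      ⟨0, ⟨le_rfl, hL.le⟩, ?_⟩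
    have hvv : inner ℂ v v ≠ 0 := inner_self_ne_zero.mpr hne
    simp only [h.zero, one_apply_eq_self]
    positivity
  nlinarith [mul_pos hL hpos]

theorem isUnit_sub_one_of_isUnit (h : IsModulatedGroup U T) {L : ℝ} (hL : 0 < L) {φ : ℝ → ℂ}
    (hφ : Continuous φ) (hφL : ∀ s, φ s ≠ 0 → |s| ≤ L) {N : H →L[ℂ] H}
    (hN : ∀ x, N x = ∫ s, φ s • U s x) {b : ℝ}
    (hD : IsUnit (algebraMap ℂ (H →L[ℂ] H) (∫ s, φ s * realChar b s) - N)) :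
    IsUnit (U L - 1) := by
  have hφs : HasCompactSupport φ := by
    refine HasCompactSupport.intro (isCompact_Icc (a := -L) (b := L)) fun s hs => ?_
    by_contra hne
    exact hs (abs_le.mp (hφL s hne))
  obtain ⟨u, hu⟩ := hD
  have hDapp : ∀ x, (u : H →L[ℂ] H) x = (∫ s, φ s * realChar b s) • x - N x := fun x => by
    rw [hu]
    simp [Algebra.algebraMap_eq_smul_one]
  have hleft : ∀ x, (↑u⁻¹ : H →L[ℂ] H) ((u : H →L[ℂ] H) x) = x := fun x => by
    rw [← mul_apply_eq_comp, Units.inv_mul, one_apply_eq_self]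
  have hright : ∀ x, (u : H →L[ℂ] H) ((↑u⁻¹ : H →L[ℂ] H) x) = x := fun x => by
    rw [← mul_apply_eq_comp, Units.mul_inv, one_apply_eq_self]
  obtain ⟨K, hK⟩ := h.exists_norm_le_mul_norm_sub hL hφ hφL hN (b := b)
    (norm_nonneg (↑u⁻¹ : H →L[ℂ] H)) fun y => by
      conv_lhs => rw [← hleft y]
      rw [← hDapp]
      exact ContinuousLinearMap.le_opNorm _ _
  rw [ContinuousLinearMap.isUnit_iff_bijective,
    ContinuousLinearMap.bijective_iff_dense_range_and_antilipschitz]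
  constructor
  · rw [Submodule.topologicalClosure_eq_top_iff, Submodule.eq_bot_iff]
    intro v hv
    refine h.eq_zero_of_forall_inner_sub_eq_zero hL hφ hφs hN
      (fun y => ⟨(↑u⁻¹ : H →L[ℂ] H) y, by rw [← hDapp, hright]⟩) fun x => ?_
    exact Submodule.inner_left_of_mem_orthogonal (LinearMap.mem_range.mpr ⟨x, by simp⟩) hv
  · refine ⟨K.toNNReal, ContinuousLinearMap.antilipschitz_of_bound _ fun x => ?_⟩
    refine (hK x).trans ?_
    simp only [_root_.sub_apply, one_apply_eq_self]
    gcongr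
    exact Real.le_coe_toNNReal K

theorem norm_integral_mul_realChar_le (h : IsModulatedGroup U T) {φ : ℝ → ℂ}
    (hφ : Continuous φ) (hφs : HasCompactSupport φ) {N : H →L[ℂ] H}
    (hN : ∀ x, N x = ∫ s, φ s • U s x) (hU : ¬IsUnit (U 1 - 1)) (b : ℝ) :
    ‖∫ s, φ s * realChar b s‖ ≤ ‖N‖ := by
  by_contra! hlt
  have hres : ∫ s, φ s * realChar b s ∈ resolventSet ℂ N := by
    refine spectrum.mem_resolventSet_of_norm_lt_mul ?_
    refine lt_of_le_of_lt ?_ hlt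
    exact mul_le_of_le_one_right (norm_nonneg _) ContinuousLinearMap.norm_id_le
  obtain ⟨r, hr⟩ := hφs.isCompact.isBounded.subset_closedBall (0 : ℝ)
  obtain ⟨n, hn⟩ := exists_nat_gt (max r 0)
  have hn0 : (0 : ℝ) < n := (le_max_right _ _).trans_lt hn
  have hunit := h.isUnit_sub_one_of_isUnit hn0 hφ (fun s hs => by
    have := hr (subset_tsupport φ hs)
    rw [mem_closedBall_zero_iff, Real.norm_eq_abs] at this
    exact this.trans ((le_max_left _ _).trans hn.le)) hN (spectrum.mem_resolventSet_iff.mp hres)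
  have hpow : ∀ j : ℕ, U j = U 1 ^ j := by
    intro j
    induction j with
    | zero => simpa using h.zero
    | succ j ih =>
      ext x
      rw [Nat.cast_succ, h.add, pow_succ, ← ih, mul_apply_eq_comp]
  have hcomm : Commute (U 1 - 1) (∑ i ∈ Finset.range n, U 1 ^ i) :=
    Commute.sum_right _ _ _ fun i _ =>
      ((Commute.refl _).sub_left (Commute.one_left _)).pow_right i
  rw [hpow, ← mul_geom_sum] at hunit
  exact hU (hcomm.isUnit_mul_iff.mp hunit).1

end IsModulatedGroup

end OperatorGroup

namespace MultiplierSetup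

variable {H : Type} [NormedAddCommGroup H] [InnerProductSpace ℂ H] [CompleteSpace H]
  (P : MultiplierSetup H)

theorem eq_of_ae_eq {f g : H} (h : (P.ι f : ℝ → ℂ) =ᵐ[volume] P.ι g) : f = g :=
  P.ι_inj (AEEqFun.ext h)

theorem ι_smul_ae (c : ℂ) (f : H) :
    (P.ι (c • f) : ℝ → ℂ) =ᵐ[volume] fun x => c * (P.ι f : ℝ → ℂ) x := by
  rw [map_smul]
  exact AEEqFun.coeFn_smul c (P.ι f)

theorem ι_comp_sub_ae {f : H} {g : ℝ → ℂ} (h : (P.ι f : ℝ → ℂ) =ᵐ[volume] g) (t : ℝ) :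
    (fun x => (P.ι f : ℝ → ℂ) (x - t)) =ᵐ[volume] fun x => g (x - t) :=
  (measurePreserving_sub_right volume t).quasiMeasurePreserving.ae_eq_comp h

theorem ofCc_sub (φ ψ : CompactlySupportedContinuousMap ℝ ℂ) :
    P.ofCc (φ - ψ) = P.ofCc φ - P.ofCc ψ := by
  apply P.eq_of_ae_eq
  rw [map_sub]
  filter_upwards [P.ofCc_spec (φ - ψ), P.ofCc_spec φ, P.ofCc_spec ψ,
    AEEqFun.coeFn_sub (P.ι (P.ofCc φ)) (P.ι (P.ofCc ψ))] with x h1 h2 h3 h4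
  rw [h1, h4, Pi.sub_apply, h2, h3]
  rfl

/-- The translate `φ(· - t)`. -/
def translate (φ : CompactlySupportedContinuousMap ℝ ℂ) (t : ℝ) :
    CompactlySupportedContinuousMap ℝ ℂ where
  toFun := fun y => φ (y - t)
  continuous_toFun := φ.continuous.comp (continuous_sub_right t)
  hasCompactSupport' := φ.hasCompactSupport.comp_homeomorph (Homeomorph.subRight t)

theorem translate_apply (φ : CompactlySupportedContinuousMap ℝ ℂ) (t y : ℝ) :
    translate φ t y = φ (y - t) := rfl

theorem S_ofCc (φ : CompactlySupportedContinuousMap ℝ ℂ) (t : ℝ) :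
    P.S t (P.ofCc φ) = P.ofCc (translate φ t) := by
  apply P.eq_of_ae_eq
  filter_upwards [P.S_spec t (P.ofCc φ), P.ofCc_spec (translate φ t),
    P.ι_comp_sub_ae (P.ofCc_spec φ) t] with x h1 h2 h3
  rw [h1, h2, h3, translate_apply]

theorem S_add_apply (s t : ℝ) (f : H) : P.S (s + t) f = P.S s (P.S t f) := by
  rw [← P.S_add]
  rfl

theorem tendsto_S_ofCc (φ : CompactlySupportedContinuousMap ℝ ℂ) :
    Tendsto (fun t => P.S t (P.ofCc φ)) (𝓝 0) (𝓝 (P.ofCc φ)) := by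
  obtain ⟨r, hr⟩ := φ.hasCompactSupport.isCompact.isBounded.subset_closedBall (0 : ℝ)
  obtain ⟨c, hc, hK, -⟩ := P.incl_cont _ (isCompact_closedBall (0 : ℝ) (r + 1))
  have hu : UniformContinuous φ :=
    φ.hasCompactSupport.uniformContinuous_of_continuous φ.continuous
  rw [Metric.tendsto_nhds_nhds]
  intro ε hε
  obtain ⟨δ, hδ, hφ⟩ := Metric.uniformContinuous_iff.mp hu (ε / (2 * c)) (by positivity)
  refine ⟨min δ 1, by positivity, fun {t} ht => ?_⟩
  rw [dist_zero_right, Real.norm_eq_abs, lt_min_iff] at ht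
  rw [S_ofCc, dist_eq_norm, ← ofCc_sub]
  have hout : ∀ x : ℝ, x ∉ Metric.closedBall (0 : ℝ) r → φ x = 0 := fun x hx =>
    image_eq_zero_of_notMem_tsupport fun h => hx (hr h)
  have hsupp : tsupport (translate φ t - φ : CompactlySupportedContinuousMap ℝ ℂ)
      ⊆ Metric.closedBall 0 (r + 1) := by
    refine closure_minimal (fun x hx => ?_) Metric.isClosed_closedBall
    by_contra hxr
    rw [mem_closedBall_zero_iff, Real.norm_eq_abs, not_le] at hxr
    refine hx ?_
    change φ (x - t) - φ x = 0
    rw [hout x, hout (x - t), sub_zero]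
    · rw [mem_closedBall_zero_iff, Real.norm_eq_abs, not_le]
      linarith [abs_sub_abs_le_abs_sub x t, ht.2]
    · rw [mem_closedBall_zero_iff, Real.norm_eq_abs, not_le]
      linarith
  have hsup : ⨆ x, ‖(translate φ t - φ : CompactlySupportedContinuousMap ℝ ℂ) x‖
      ≤ ε / (2 * c) := by
    refine ciSup_le fun x => ?_
    have := hφ (a := x - t) (b := x) (by simpa [Real.dist_eq] using ht.1)
    rw [dist_eq_norm] at this
    exact this.le
  calc ‖P.ofCc (translate φ t - φ)‖ ≤ c * (ε / (2 * c)) := by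
        refine (hK _ hsupp).trans ?_
        gcongr
    _ = ε / 2 := by field_simp
    _ < ε := by linarith

theorem tendsto_S_zero (f : H) : Tendsto (fun t => P.S t f) (𝓝 0) (𝓝 f) := by
  obtain ⟨M, hM⟩ := P.S_loc_bdd _ (isCompact_closedBall (0 : ℝ) 1)
  have hM0 : 0 ≤ M := (norm_nonneg _).trans (hM 0 (by simp))
  rw [Metric.tendsto_nhds]
  intro ε hε
  obtain ⟨φ, hφ⟩ := P.ofCc_dense.exists_dist_lt f (ε := ε / (2 * (M + 1))) (by positivity)
  filter_upwards [Metric.tendsto_nhds.mp (P.tendsto_S_ofCc φ) (ε / 2) (by positivity),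
    Metric.closedBall_mem_nhds (0 : ℝ) one_pos] with t ht1 ht2
  have h1 : dist (P.S t f) (P.S t (P.ofCc φ)) ≤ M * dist f (P.ofCc φ) := by
    rw [dist_eq_norm, dist_eq_norm, ← map_sub]
    exact (P.S t).le_of_opNorm_le (hM t ht2) _
  have h2 : (M + 1) * dist f (P.ofCc φ) < ε / 2 := by
    calc (M + 1) * dist f (P.ofCc φ) < (M + 1) * (ε / (2 * (M + 1))) := by gcongr
      _ = ε / 2 := by field_simp
  calc dist (P.S t f) f
      ≤ dist (P.S t f) (P.S t (P.ofCc φ)) + dist (P.S t (P.ofCc φ)) (P.ofCc φ)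
          + dist (P.ofCc φ) f := dist_triangle4 _ _ _ _
    _ < ε := by
        rw [dist_comm (P.ofCc φ) f]
        linarith

theorem continuous_S (f : H) : Continuous fun t => P.S t f := by
  rw [continuous_iff_continuousAt]
  intro t
  have h : Tendsto (fun s : ℝ => s - t) (𝓝 t) (𝓝 0) := by
    have : Continuous fun s : ℝ => s - t := by fun_prop
    simpa using this.tendsto t
  have h2 := ((P.S t).continuous.tendsto f).comp ((P.tendsto_S_zero f).comp h)
  refine h2.congr fun s => ?_
  simp only [Function.comp_apply, ← S_add_apply, add_sub_cancel]

theorem T_comp_neg (α : ℝ) (f : H) : P.T α (P.T (-α) f) = f := by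
  apply P.eq_of_ae_eq
  filter_upwards [P.T_spec α (P.T (-α) f), P.T_spec (-α) f] with x h1 h2
  rw [h1, h2, ← mul_assoc, ← Complex.exp_add]
  simp

theorem T_S (α s : ℝ) (f : H) : P.T α (P.S s f) = realChar α s • P.S s (P.T α f) := by
  apply P.eq_of_ae_eq
  filter_upwards [P.T_spec α (P.S s f), P.S_spec s f, P.ι_smul_ae (realChar α s) (P.S s (P.T α f)),
    P.S_spec s (P.T α f), P.ι_comp_sub_ae (P.T_spec α f) s] with x h1 h2 h3 h4 h5
  rw [h1, h2, h3, h4, h5, ← mul_assoc, realChar, ← Complex.exp_add]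
  congr 2
  push_cast
  ring

/-- Integration over a compact set, as a continuous functional on `H`. -/
def setIntegralCLM {K : Set ℝ} (hK : IsCompact K) : H →L[ℂ] ℂ :=
  LinearMap.mkContinuousOfExistsBound
    { toFun := fun f => ∫ x in K, (P.ι f : ℝ → ℂ) x
      map_add' := fun f g => by
        rw [map_add, ← integral_add ((P.locInt f).integrableOn_isCompact hK)
          ((P.locInt g).integrableOn_isCompact hK)]
        exact integral_congr_ae (ae_restrict_of_ae (AEEqFun.coeFn_add _ _))
      map_smul' := fun c f => by
        rw [RingHom.id_apply, smul_eq_mul, ← integral_const_mul]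
        exact integral_congr_ae (ae_restrict_of_ae (P.ι_smul_ae c f)) }
    (by
      obtain ⟨c, -, -, hc⟩ := P.incl_cont K hK
      exact ⟨c, fun f => (norm_integral_le_integral_norm _).trans (hc f)⟩)

theorem setIntegralCLM_apply {K : Set ℝ} (hK : IsCompact K) (f : H) :
    P.setIntegralCLM hK f = ∫ x in K, (P.ι f : ℝ → ℂ) x := rfl

theorem eq_of_forall_setIntegralCLM_eq {f g : H}
    (h : ∀ (K : Set ℝ) (hK : IsCompact K), P.setIntegralCLM hK f = P.setIntegralCLM hK g) :
    f = g := by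
  have hz : (P.ι (f - g) : ℝ → ℂ) =ᵐ[volume] 0 := by
    refine ae_eq_zero_of_forall_setIntegral_isCompact_eq_zero' (P.locInt _) fun K hK => ?_
    rw [← P.setIntegralCLM_apply hK, map_sub, h K hK, sub_self]
  rw [map_sub] at hz
  apply P.eq_of_ae_eq
  filter_upwards [hz, AEEqFun.coeFn_sub (P.ι f) (P.ι g)] with x h1 h2
  rw [h2, Pi.sub_apply, Pi.zero_apply, sub_eq_zero] at h1
  exact h1

/-- Convolution by `φ` is the operator integral `∫ φ(s) S_s ds`. -/
theorem eq_integral_smul_S (φ : CompactlySupportedContinuousMap ℝ ℂ) (N : H →L[ℂ] H)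
    (hN : ∀ f : H, (P.ι (N f) : ℝ → ℂ) =ᵐ[volume]
      fun x => ∫ y : ℝ, (P.ι f : ℝ → ℂ) (x - y) * φ y) (f : H) :
    N f = ∫ s, φ s • P.S s f := by
  have hS := P.continuous_S
  have hφ := φ.continuous
  have hint : Integrable fun s => φ s • P.S s f :=
    Continuous.integrable_of_hasCompactSupport (by fun_prop) φ.hasCompactSupport.smul_right
  refine P.eq_of_forall_setIntegralCLM_eq fun K hK => ?_
  have hK' : IsCompact ((fun p : ℝ × ℝ => p.1 - p.2) '' (K ×ˢ tsupport φ)) :=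
    (hK.prod φ.hasCompactSupport.isCompact).image continuous_sub
  set K' := (fun p : ℝ × ℝ => p.1 - p.2) '' (K ×ˢ tsupport φ)
  have hf0 : Integrable (K'.indicator (P.ι f : ℝ → ℂ)) :=
    ((P.locInt f).integrableOn_isCompact hK').integrable_indicator hK'.measurableSet
  have hφi : Integrable φ :=
    hφ.integrable_of_hasCompactSupport φ.hasCompactSupport
  have hconv := (hφi.convolution_integrand (ContinuousLinearMap.mul ℝ ℂ) hf0).restrict
    (s := K ×ˢ Set.univ)
  have hprod : Integrable (fun p : ℝ × ℝ => (P.ι f : ℝ → ℂ) (p.1 - p.2) * φ p.2)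
      ((volume.restrict K).prod volume) := by
    have hm : (volume.restrict K).prod (volume : Measure ℝ)
        = (volume.prod volume).restrict (K ×ˢ Set.univ) := by
      rw [← Measure.prod_restrict, Measure.restrict_univ]
    rw [hm]
    refine hconv.congr ?_
    filter_upwards [ae_restrict_mem (hK.measurableSet.prod MeasurableSet.univ)] with p hp
    rw [ContinuousLinearMap.mul_apply', mul_comm]
    by_cases hp2 : p.2 ∈ tsupport φ
    · have hmem : p.1 - p.2 ∈ K' := ⟨p, ⟨hp.1, hp2⟩, rfl⟩
      rw [Set.indicator_of_mem hmem]
    · simp [image_eq_zero_of_notMem_tsupport hp2]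
  rw [← (P.setIntegralCLM hK).integral_comp_comm hint]
  calc P.setIntegralCLM hK (N f)
      = ∫ x in K, ∫ y : ℝ, (P.ι f : ℝ → ℂ) (x - y) * φ y :=
        integral_congr_ae (ae_restrict_of_ae (hN f))
    _ = ∫ y : ℝ, ∫ x in K, (P.ι f : ℝ → ℂ) (x - y) * φ y := integral_integral_swap hprod
    _ = ∫ s, P.setIntegralCLM hK (φ s • P.S s f) := by
        refine integral_congr_ae (Eventually.of_forall fun s => ?_)
        change _ = P.setIntegralCLM hK (φ s • P.S s f)
        rw [map_smul, setIntegralCLM_apply, smul_eq_mul, mul_comm, ← integral_mul_const]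
        refine integral_congr_ae (ae_restrict_of_ae ?_)
        filter_upwards [P.S_spec s f] with x hx
        rw [hx]

theorem isModulatedGroup (lam : ℂ) :
    IsModulatedGroup (fun t : ℝ => Complex.exp (-(lam * t)) • P.S t) P.T where
  zero := by simp [P.S_zero]
  add s t x := by
    simp only [_root_.smul_apply, map_smul, P.S_add_apply, smul_smul, ← Complex.exp_add]
    congr 2
    push_cast
    ring
  cont x := by
    have := P.continuous_S
    simp only [_root_.smul_apply]
    fun_prop
  bdd R := by
    obtain ⟨M, hM⟩ := P.S_loc_bdd _ (isCompact_closedBall (0 : ℝ) R)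
    have hexp : Continuous fun t : ℝ => Complex.exp (-(lam * t)) := by fun_prop
    obtain ⟨E, hE⟩ := (isCompact_closedBall (0 : ℝ) R).exists_bound_of_continuousOn
      hexp.continuousOn
    refine ⟨max (E * M) 1, by positivity, fun t ht => le_trans ?_ (le_max_left _ _)⟩
    have ht' : t ∈ Metric.closedBall (0 : ℝ) R := by simpa using ht
    rw [norm_smul]
    exact mul_le_mul (hE t ht') (hM t ht') (norm_nonneg _) ((norm_nonneg _).trans (hE t ht'))
  mod_bdd := by
    obtain ⟨C, hC⟩ := P.T_bdd
    exact ⟨max C 1, by positivity, fun α => (hC α).trans (le_max_left _ _)⟩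
  mod_inv := P.T_comp_neg
  mod_comm α s x := by
    simp only [_root_.smul_apply, map_smul, P.T_S]
    rw [smul_comm]

end MultiplierSetup

/-- If `e^λ ∈ σ(S)` then for every `a ∈ ℝ` one has
`|∫ φ(t) e^(λ t) e^(i a t) dt| ≤ ‖M_φ‖`, where `M_φ` is the convolution operator
by `φ ∈ C_c(ℝ)` on `H`. -/
theorem fourier_bound_on_line {H : Type} [NormedAddCommGroup H]
    [InnerProductSpace ℂ H] [CompleteSpace H] (P : MultiplierSetup H)
    (φ : CompactlySupportedContinuousMap ℝ ℂ) (N : H →L[ℂ] H)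
    (hN : ∀ f : H, (P.ι (N f) : ℝ → ℂ) =ᵐ[volume]
      fun x => ∫ y : ℝ, (P.ι f : ℝ → ℂ) (x - y) * φ y)
    (lam : ℂ) (hlam : Complex.exp lam ∈ spectrum ℂ (P.S 1)) (a : ℝ) :
    ‖∫ t : ℝ, φ t * Complex.exp (lam * t) * Complex.exp (Complex.I * a * t)‖ ≤ ‖N‖ := by
  have hU : ¬IsUnit (Complex.exp (-(lam * (1 : ℝ))) • P.S 1 - 1) := by
    intro hu
    refine hlam ?_
    have hc : IsUnit (algebraMap ℂ (H →L[ℂ] H) (-Complex.exp lam)) :=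
      (isUnit_iff_ne_zero.mpr (neg_ne_zero.mpr (Complex.exp_ne_zero _))).map _
    rw [spectrum.mem_resolventSet_iff]
    convert! hc.mul hu using 1
    rw [Algebra.algebraMap_eq_smul_one, Algebra.algebraMap_eq_smul_one, smul_one_mul, smul_sub,
      smul_smul, neg_mul, ← Complex.exp_add]
    simp [neg_add_eq_sub]
  have h := (P.isModulatedGroup lam).norm_integral_mul_realChar_le
    (φ := fun t : ℝ => φ t * Complex.exp (lam * t))
    (φ.continuous.mul (by fun_prop)) φ.hasCompactSupport.mul_right (N := N) (fun x => ?_) hU a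
  · exact h
  · rw [P.eq_integral_smul_S φ N hN]
    congr 1
    funext s
    rw [_root_.smul_apply, smul_smul, mul_assoc, ← Complex.exp_add]
    simp
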